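/- Let Γ be a *-semigroup acting on a nonempty set X, Z an ordered *-space, H a VE-space over Z, and k : X × X → L*(H) a Hermitian kernel. If there exist an H-reproducing kernel VE-space R on X with kernel k and a *-representation ρ : Γ → L*(R) such that ρ(ξ)(k_x h) = k_{ξ·x} h for all ξ ∈ Γ, x ∈ X, h ∈ H, then k is positive semidefinite and invariant under the action of Γ on X. -/

import Mathlib

noncomputable section

/-- An ordered `*`-space structure on a complex vector space `Z` with involution:
a strict cone of selfadjoint elements. -/
structure StarCone (Z : Type*) [AddCommGroup Z] [Module ℂ Z] [StarAddMonoid Z]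
    [StarModule ℂ Z] where
  pos : Set Z
  zero_mem : (0 : Z) ∈ pos
  add_mem : ∀ {x y : Z}, x ∈ pos → y ∈ pos → x + y ∈ pos
  smul_mem : ∀ {r : ℝ}, 0 ≤ r → ∀ {x : Z}, x ∈ pos → (r : ℂ) • x ∈ pos
  strict : ∀ {x : Z}, x ∈ pos → -x ∈ pos → x = 0
  star_mem : ∀ {x : Z}, x ∈ pos → star x = x

/-- The partial order induced by the cone: `a ≤ b` iff `b - a` is positive. -/
def StarCone.le {Z : Type*} [AddCommGroup Z] [Module ℂ Z] [StarAddMonoid Z] [StarModule ℂ Z]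
    (O : StarCone Z) (a b : Z) : Prop :=
  b - a ∈ O.pos

/-- A VE-space gramian on `E` over the ordered `*`-space `(Z, O)`: linear in the second
variable, Hermitian, positive and definite. -/
structure Gramian {Z : Type*} [AddCommGroup Z] [Module ℂ Z] [StarAddMonoid Z] [StarModule ℂ Z]
    (O : StarCone Z) (E : Type*) [AddCommGroup E] [Module ℂ E] where
  inner : E → E → Z
  add_right : ∀ x y z : E, inner x (y + z) = inner x y + inner x z
  smul_right : ∀ (c : ℂ) (x y : E), inner x (c • y) = c • inner x y
  conj_symm : ∀ x y : E, inner x y = star (inner y x)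
  inner_self_mem : ∀ x : E, inner x x ∈ O.pos
  definite : ∀ x : E, inner x x = 0 → x = 0

/-- A linear map `T` between VE-spaces over the same ordered `*`-space is adjointable if
it has an adjoint `S` with `[T e, f] = [e, S f]`. -/
def Adjointable {Z : Type*} [AddCommGroup Z] [Module ℂ Z] [StarAddMonoid Z] [StarModule ℂ Z]
    {O : StarCone Z} {E F : Type*} [AddCommGroup E] [Module ℂ E] [AddCommGroup F] [Module ℂ F]
    (gE : Gramian O E) (gF : Gramian O F) (T : E →ₗ[ℂ] F) : Prop :=
  ∃ S : F →ₗ[ℂ] E, ∀ (e : E) (f : F), gF.inner (T e) f = gE.inner e (S f)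

namespace Gramian

variable {Z : Type*} [AddCommGroup Z] [Module ℂ Z] [StarAddMonoid Z] [StarModule ℂ Z]
  {O : StarCone Z} {E : Type*} [AddCommGroup E] [Module ℂ E] (g : Gramian O E)

theorem add_left (x y z : E) : g.inner (x + y) z = g.inner x z + g.inner y z := by
  rw [g.conj_symm, g.add_right, star_add, ← g.conj_symm, ← g.conj_symm]

theorem sum_right {ι : Type*} (s : Finset ι) (x : E) (f : ι → E) :
    g.inner x (∑ i ∈ s, f i) = ∑ i ∈ s, g.inner x (f i) :=
  map_sum (AddMonoidHom.mk' (g.inner x) (g.add_right x)) f s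

theorem sum_left {ι : Type*} (s : Finset ι) (f : ι → E) (y : E) :
    g.inner (∑ i ∈ s, f i) y = ∑ i ∈ s, g.inner (f i) y :=
  map_sum (AddMonoidHom.mk' (fun x => g.inner x y) fun a b => g.add_left a b y) f s

theorem sub_left (x y z : E) : g.inner (x - y) z = g.inner x z - g.inner y z :=
  map_sub (AddMonoidHom.mk' (fun x => g.inner x z) fun a b => g.add_left a b z) x y

theorem ext_left {x y : E} (h : ∀ z, g.inner x z = g.inner y z) : x = y :=
  sub_eq_zero.mp <| g.definite _ <| by rw [g.sub_left, h, sub_self]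

end Gramian

/-- if a Hermitian kernel `k` admits an `H`-reproducing kernel VE-space `R`
on `X` with kernel `k` and a `*`-representation `ρ : Γ → L*(R)` with
`ρ(ξ)(k_x h) = k_{ξ·x} h`, then `k` is positive semidefinite and invariant under the
action of `Γ` on `X`. -/
theorem invariant_reproducing_kernel_implies_posdef_invariant
    {Z : Type*} [AddCommGroup Z] [Module ℂ Z] [StarAddMonoid Z] [StarModule ℂ Z]
    (O : StarCone Z)
    {H : Type*} [AddCommGroup H] [Module ℂ H] (gH : Gramian O H)
    {Γ : Type*} [Semigroup Γ] [StarMul Γ]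
    {X : Type*} [Nonempty X]
    (act : Γ → X → X)
    (hact : ∀ (ξ η : Γ) (x : X), act ξ (act η x) = act (ξ * η) x)
    (k : X → X → (H →ₗ[ℂ] H))
    (hadj : ∀ x y : X, Adjointable gH gH (k x y))
    -- `k` is Hermitian: `k(y,x) = k(x,y)*`
    (hherm : ∀ (x y : X) (f g : H), gH.inner (k y x f) g = gH.inner f (k x y g))
    (R : Submodule ℂ (X → H)) (gR : Gramian O ↥R) (ρ : Γ → (↥R →ₗ[ℂ] ↥R))
    (hmem : ∀ (x : X) (h : H), (fun y => k y x h) ∈ R)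
    -- reproducing property
    (hrepr : ∀ (f : ↥R) (x : X) (h : H),
      gH.inner ((f : X → H) x) h = gR.inner f ⟨fun y => k y x h, hmem x h⟩)
    -- `ρ` is a `*`-representation: multiplicative with `ρ(ξ*) = ρ(ξ)*`
    (hρmul : ∀ ξ η : Γ, ρ (ξ * η) = (ρ ξ).comp (ρ η))
    (hρstar : ∀ (ξ : Γ) (f g : ↥R), gR.inner (ρ ξ f) g = gR.inner f (ρ (star ξ) g))
    -- `ρ(ξ)(k_x h) = k_{ξ·x} h`
    (hρk : ∀ (ξ : Γ) (x : X) (h : H),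
      ρ ξ ⟨fun y => k y x h, hmem x h⟩ = ⟨fun y => k y (act ξ x) h, hmem (act ξ x) h⟩) :
    (∀ (n : ℕ) (x : Fin n → X) (h : Fin n → H),
      (∑ i : Fin n, ∑ j : Fin n, gH.inner (k (x i) (x j) (h j)) (h i)) ∈ O.pos) ∧
    (∀ (ξ : Γ) (x y : X), k y (act ξ x) = k (act (star ξ) y) x) := by
  refine ⟨fun n x h => ?_, fun ξ x y => LinearMap.ext fun f => gH.ext_left fun g => ?_⟩
  · have key := gR.inner_self_mem
      (∑ i : Fin n, (⟨fun y => k y (x i) (h i), hmem (x i) (h i)⟩ : ↥R))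
    simp only [gR.sum_right, gR.sum_left, ← hrepr] at key
    exact key
  · calc gH.inner (k y (act ξ x) f) g
        = gR.inner (ρ ξ ⟨fun z => k z x f, hmem x f⟩) ⟨fun z => k z y g, hmem y g⟩ := by
          rw [hρk, ← hrepr]
      _ = gH.inner (k (act (star ξ) y) x f) g := by
          rw [hρstar, hρk, ← hrepr]
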